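/- Let L > 0, set λ = (2π/L)⁴, and let h be a smooth solution of the Metropolis crystal-surface PDE on t ≥ 0 whose initial profile is mean-zero, ∫₀ᴸ h(0,x) dx = 0. Write φ(h(t)) = ∫₀ᴸ cosh(∂ₓₓ h(t,x)) dx. Then for all t ≥ 0: (i) φ(h(t)) − L ≤ (φ(h(0)) − L) e^{−2λ t}, and (ii) (λ/2) ∫₀ᴸ h(t,x)² dx ≤ φ(h(t)) − L; consequently ∫₀ᴸ h(t,x)² dx ≤ (2/λ)(φ(h(0)) − L) e^{−2λ t}, so the solution converges exponentially in L² to the equilibrium h* = 0. -/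

import Mathlib

open Set MeasureTheory
open scoped ContDiff Topology

/-- **Wirtinger's inequality** for mean-zero functions with equal boundary values on `[0, L]`. -/
theorem wirtinger_inequality {L : ℝ} (hL : 0 < L) {f f' : ℝ → ℝ}
    (hf : ∀ x, HasDerivAt f (f' x) x) (hf' : Continuous f') (hper : f L = f 0)
    (hmean : ∫ x in (0 : ℝ)..L, f x = 0) :
    (2 * Real.pi / L) ^ 2 * ∫ x in (0 : ℝ)..L, f x ^ 2 ≤ ∫ x in (0 : ℝ)..L, f' x ^ 2 := by
  have hfc : Continuous f := continuous_iff_continuousAt.2 fun x => (hf x).continuousAt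
  have memLp {g : ℝ → ℝ} (hg : Continuous g) :
      MemLp (fun x => (g x : ℂ)) 2 (volume.restrict (Ioc 0 L)) := by
    have hgc : Continuous fun x => (g x : ℂ) := Complex.continuous_ofReal.comp hg
    obtain ⟨C, hC⟩ :=
      (isCompact_Icc (a := 0) (b := L)).exists_bound_of_continuousOn hgc.continuousOn
    exact .of_bound hgc.aestronglyMeasurable C ((ae_restrict_iff' measurableSet_Ioc).2
      (.of_forall fun x hx => hC x (Ioc_subset_Icc_self hx)))
  have parseval_f := hasSum_sq_fourierCoeffOn hL (memLp hfc)
  have parseval_f' := hasSum_sq_fourierCoeffOn hL (memLp hf')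
  simp only [Complex.norm_real, Real.norm_eq_abs, sq_abs, smul_eq_mul, sub_zero]
    at parseval_f parseval_f'
  have coeff_le (n : ℤ) : (2 * Real.pi / L) ^ 2 *
      ‖fourierCoeffOn hL (fun x => (f x : ℂ)) n‖ ^ 2 ≤
        ‖fourierCoeffOn hL (fun x => (f' x : ℂ)) n‖ ^ 2 := by
    rcases eq_or_ne n 0 with rfl | hn
    · have : fourierCoeffOn hL (fun x => (f x : ℂ)) 0 = 0 := by
        rw [fourierCoeffOn_eq_integral]
        simp [intervalIntegral.integral_ofReal, hmean]
      rw [this, norm_zero, zero_pow two_ne_zero, mul_zero]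
      positivity
    · have key := fourierCoeffOn_of_hasDerivAt hL hn
        (f := fun x => (f x : ℂ)) (f' := fun x => (f' x : ℂ))
        (fun x _ => (hf x).ofReal_comp)
        ((Complex.continuous_ofReal.comp hf').intervalIntegrable _ _)
      rw [key, hper]
      have hn1 : (1 : ℝ) ≤ |(n : ℝ)| := by exact_mod_cast Int.one_le_abs hn
      simp only [sub_self, mul_zero, zero_sub, Complex.ofReal_zero, sub_zero, norm_mul, norm_neg,
        norm_div, norm_one, Complex.norm_real, Complex.norm_I, Complex.norm_intCast,
        Real.norm_eq_abs, abs_of_pos Real.pi_pos, abs_of_pos hL, Complex.norm_ofNat, mul_one]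
      rw [← mul_pow]
      refine pow_le_pow_left₀ (by positivity) ?_ 2
      have hpi := Real.pi_pos
      have : 2 * Real.pi / L * (1 / (2 * Real.pi * |(n : ℝ)|) *
          (L * ‖fourierCoeffOn hL (fun x => (f' x : ℂ)) n‖)) =
          ‖fourierCoeffOn hL (fun x => (f' x : ℂ)) n‖ / |(n : ℝ)| := by
        field_simp
      rw [this]
      exact div_le_self (norm_nonneg _) hn1
  have := hasSum_le coeff_le (parseval_f.mul_left _) parseval_f'
  rw [mul_left_comm] at this
  exact le_of_mul_le_mul_left this (inv_pos.2 hL)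

/-- Second-order Wirtinger inequality for mean-zero functions with periodic boundary values. -/
theorem wirtinger_inequality_second_order {L : ℝ} (hL : 0 < L) {f f' f'' : ℝ → ℝ}
    (hf : ∀ x, HasDerivAt f (f' x) x) (hf' : ∀ x, HasDerivAt f' (f'' x) x)
    (hf'' : Continuous f'') (hper : f L = f 0) (hper' : f' L = f' 0)
    (hmean : ∫ x in (0 : ℝ)..L, f x = 0) :
    (2 * Real.pi / L) ^ 4 * ∫ x in (0 : ℝ)..L, f x ^ 2 ≤ ∫ x in (0 : ℝ)..L, f'' x ^ 2 := by
  have hc : Continuous f' := continuous_iff_continuousAt.2 fun x => (hf' x).continuousAt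
  have hmean' : ∫ x in (0 : ℝ)..L, f' x = 0 := by
    rw [intervalIntegral.integral_eq_sub_of_hasDerivAt (fun x _ => hf x)
      (hc.intervalIntegrable _ _), hper, sub_self]
  calc (2 * Real.pi / L) ^ 4 * ∫ x in (0 : ℝ)..L, f x ^ 2
      = (2 * Real.pi / L) ^ 2 * ((2 * Real.pi / L) ^ 2 * ∫ x in (0 : ℝ)..L, f x ^ 2) := by ring
    _ ≤ (2 * Real.pi / L) ^ 2 * ∫ x in (0 : ℝ)..L, f' x ^ 2 := by
        gcongr
        exact wirtinger_inequality hL hf hc hper hmean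
    _ ≤ _ := wirtinger_inequality hL hf' hf'' hper' hmean'

/-- Two integrations by parts with periodic boundary values. -/
theorem integral_mul_second_deriv_eq {L : ℝ} {u u' u'' v v' v'' : ℝ → ℝ}
    (hu : ∀ x, HasDerivAt u (u' x) x) (hu' : ∀ x, HasDerivAt u' (u'' x) x) (hu'' : Continuous u'')
    (hv : ∀ x, HasDerivAt v (v' x) x) (hv' : ∀ x, HasDerivAt v' (v'' x) x) (hv'' : Continuous v'')
    (hpu : u L = u 0) (hpu' : u' L = u' 0) (hpv : v L = v 0) (hpv' : v' L = v' 0) :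
    ∫ x in (0 : ℝ)..L, u x * v'' x = ∫ x in (0 : ℝ)..L, u'' x * v x := by
  have hcu : Continuous u' := continuous_iff_continuousAt.2 fun x => (hu' x).continuousAt
  have hcv : Continuous v' := continuous_iff_continuousAt.2 fun x => (hv' x).continuousAt
  rw [intervalIntegral.integral_mul_deriv_eq_deriv_mul (fun x _ => hu x) (fun x _ => hv' x)
      (hcu.intervalIntegrable _ _) (hv''.intervalIntegrable _ _),
    intervalIntegral.integral_mul_deriv_eq_deriv_mul (fun x _ => hu' x) (fun x _ => hv x)
      (hu''.intervalIntegrable _ _) (hcv.intervalIntegrable _ _), hpu, hpu', hpv, hpv']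
  ring

/-- The derivative of `G` in the constant direction `v`. -/
noncomputable def directionalDeriv (v : ℝ × ℝ) (G : ℝ × ℝ → ℝ) (p : ℝ × ℝ) : ℝ :=
  fderiv ℝ G p v

theorem contDiff_directionalDeriv {G : ℝ × ℝ → ℝ} (hG : ContDiff ℝ ∞ G)
    (v : ℝ × ℝ) : ContDiff ℝ ∞ (directionalDeriv v G) :=
  (hG.fderiv_right (m := ∞) (by simp)).clm_apply contDiff_const

theorem hasDerivAt_fst_directionalDeriv {G : ℝ × ℝ → ℝ} (hG : ContDiff ℝ ∞ G)
    (t x : ℝ) :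
    HasDerivAt (fun s => G (s, x)) (directionalDeriv (1, 0) G (t, x)) t :=
  ((hG.differentiable (by simp)) (t, x)).hasFDerivAt.comp_hasDerivAt t
    ((hasDerivAt_id t).prodMk (hasDerivAt_const t x))

theorem hasDerivAt_snd_directionalDeriv {G : ℝ × ℝ → ℝ} (hG : ContDiff ℝ ∞ G)
    (t x : ℝ) :
    HasDerivAt (fun y => G (t, y)) (directionalDeriv (0, 1) G (t, x)) x :=
  ((hG.differentiable (by simp)) (t, x)).hasFDerivAt.comp_hasDerivAt x
    ((hasDerivAt_const x t).prodMk (hasDerivAt_id x))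

theorem directionalDeriv_comm {G : ℝ × ℝ → ℝ} (hG : ContDiff ℝ ∞ G)
    (v w : ℝ × ℝ) :
    directionalDeriv v (directionalDeriv w G) = directionalDeriv w (directionalDeriv v G) := by
  have hd : Differentiable ℝ (fderiv ℝ G) :=
    (hG.fderiv_right (m := ∞) (by simp)).differentiable (by simp)
  have apply_eq (a b p : ℝ × ℝ) : directionalDeriv a (directionalDeriv b G) p =
      fderiv ℝ (fderiv ℝ G) p a b := by
    change fderiv ℝ (fun q => fderiv ℝ G q b) p a = _
    rw [fderiv_clm_apply (hd p) (differentiableAt_const b)]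
    simp
  funext p
  rw [apply_eq, apply_eq]
  have hG2 : ContDiff ℝ 2 G := hG.of_le (WithTop.coe_le_coe.2 le_top)
  exact (hG2.contDiffAt.isSymmSndFDerivAt (by simp)).eq v w

theorem deriv_fst_eq_directionalDeriv {G : ℝ × ℝ → ℝ} (hG : ContDiff ℝ ∞ G)
    (t x : ℝ) :
    deriv (fun s => G (s, x)) t = directionalDeriv (1, 0) G (t, x) :=
  (hasDerivAt_fst_directionalDeriv hG t x).deriv

theorem deriv_snd_eq_directionalDeriv {G : ℝ × ℝ → ℝ} (hG : ContDiff ℝ ∞ G)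
    (t : ℝ) :
    deriv (fun y => G (t, y)) = fun x => directionalDeriv (0, 1) G (t, x) :=
  funext fun x => (hasDerivAt_snd_directionalDeriv hG t x).deriv

/-- Differentiation under the integral sign for smooth functions on the plane. -/
theorem hasDerivAt_integral_directionalDeriv {G : ℝ × ℝ → ℝ} (hG : ContDiff ℝ ∞ G)
    (a b t : ℝ) :
    HasDerivAt (fun s => ∫ x in a..b, G (s, x))
      (∫ x in a..b, directionalDeriv (1, 0) G (t, x)) t := by
  have hc := hG.continuous
  have hc' := (contDiff_directionalDeriv hG (1, 0)).continuous
  obtain ⟨C, hC⟩ := ((isCompact_closedBall t 1).prod (isCompact_uIcc (a := a) (b := b))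
    ).exists_bound_of_continuousOn hc'.continuousOn
  refine (intervalIntegral.hasDerivAt_integral_of_dominated_loc_of_deriv_le
    (F := fun s x => G (s, x)) (F' := fun s x => directionalDeriv (1, 0) G (s, x))
    (bound := fun _ => C) (Metric.closedBall_mem_nhds t one_pos) ?_ ?_ ?_ ?_ ?_ ?_).2
  · exact .of_forall fun s => (hc.comp (Continuous.prodMk_right s)).aestronglyMeasurable
  · exact (hc.comp (Continuous.prodMk_right t)).intervalIntegrable _ _
  · exact (hc'.comp (Continuous.prodMk_right t)).aestronglyMeasurable
  · exact .of_forall fun x hx s hs => hC (s, x) ⟨hs, uIoc_subset_uIcc hx⟩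
  · exact continuous_const.intervalIntegrable _ _
  · exact .of_forall fun x _ s _ => hasDerivAt_fst_directionalDeriv hG s x

theorem directionalDeriv_periodic {G : ℝ × ℝ → ℝ} {c : ℝ × ℝ} (hG : Function.Periodic G c)
    (v : ℝ × ℝ) : Function.Periodic (directionalDeriv v G) c := fun p => by
  change fderiv ℝ G (p + c) v = fderiv ℝ G p v
  rw [← fderiv_comp_add_right, hG.funext]

theorem one_add_sq_div_two_le_cosh (u : ℝ) : 1 + u ^ 2 / 2 ≤ Real.cosh u := by
  have hhalf : Real.cosh u = 1 + 2 * Real.sinh (u / 2) ^ 2 := by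
    have := Real.cosh_two_mul (u / 2)
    rw [mul_div_cancel₀ u two_ne_zero, Real.cosh_sq] at this
    linarith
  have habs : |u / 2| ≤ |Real.sinh (u / 2)| := by
    rw [Real.abs_sinh]
    exact Real.self_le_sinh_iff.2 (abs_nonneg _)
  have := sq_le_sq.2 habs
  linarith

/-- Strong convexity of `cosh`, comparing its values at `u` and `0`. -/
theorem cosh_sub_one_le (u : ℝ) : Real.cosh u - 1 ≤ u * Real.sinh u - u ^ 2 / 2 := by
  have hd (v : ℝ) : HasDerivAt (fun v => v * Real.sinh v - v ^ 2 / 2 - Real.cosh v)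
      (v * (Real.cosh v - 1)) v := by
    refine ((((hasDerivAt_id v).mul (Real.hasDerivAt_sinh v)).sub
      (((hasDerivAt_id v).pow 2).div_const 2)).sub (Real.hasDerivAt_cosh v)).congr_deriv ?_
    simp
    ring
  have hmono : MonotoneOn (fun v => v * Real.sinh v - v ^ 2 / 2 - Real.cosh v) (Ici 0) := by
    refine monotoneOn_of_deriv_nonneg (convex_Ici 0)
      (fun v _ => (hd v).continuousAt.continuousWithinAt)
      (fun v _ => (hd v).differentiableAt.differentiableWithinAt) fun v hv => ?_
    rw [interior_Ici] at hv
    rw [(hd v).deriv]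
    exact mul_nonneg hv.le (sub_nonneg.2 (Real.one_le_cosh v))
  have hnonneg {v : ℝ} (hv : 0 ≤ v) : Real.cosh v - 1 ≤ v * Real.sinh v - v ^ 2 / 2 := by
    have := hmono self_mem_Ici hv hv
    norm_num at this
    linarith
  rcases le_total 0 u with hu | hu
  · exact hnonneg hu
  · simpa using hnonneg (neg_nonneg.2 hu)

/-- Energy–dissipation inequality: for a mean-zero function `u`, the excess energy is bounded by
the variance of `sinh u`, stated for an arbitrary centring constant `c`. -/
theorem two_mul_integral_cosh_sub_le {L : ℝ} (hL : 0 < L) {u : ℝ → ℝ} (hu : Continuous u)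
    (hmean : ∫ x in (0 : ℝ)..L, u x = 0) (c : ℝ) :
    2 * ((∫ x in (0 : ℝ)..L, Real.cosh (u x)) - L) ≤
      ∫ x in (0 : ℝ)..L, (Real.sinh (u x) - c) ^ 2 := by
  have hcosh : Continuous fun x => Real.cosh (u x) := Real.continuous_cosh.comp hu
  have hsinh : Continuous fun x => Real.sinh (u x) := Real.continuous_sinh.comp hu
  have hle : ∫ x in (0 : ℝ)..L, (2 * Real.cosh (u x) - 2 - 2 * c * u x) ≤
      ∫ x in (0 : ℝ)..L, (Real.sinh (u x) - c) ^ 2 := by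
    refine intervalIntegral.integral_mono_on hL.le
      (Continuous.intervalIntegrable (by fun_prop) _ _)
      (Continuous.intervalIntegrable (by fun_prop) _ _) fun x _ => ?_
    nlinarith [cosh_sub_one_le (u x), sq_nonneg (Real.sinh (u x) - c - u x)]
  have heq : ∫ x in (0 : ℝ)..L, (2 * Real.cosh (u x) - 2 - 2 * c * u x) =
      2 * ((∫ x in (0 : ℝ)..L, Real.cosh (u x)) - L) := by
    rw [intervalIntegral.integral_sub (Continuous.intervalIntegrable (by fun_prop) _ _)
        (Continuous.intervalIntegrable (by fun_prop) _ _),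
      intervalIntegral.integral_sub (Continuous.intervalIntegrable (by fun_prop) _ _)
        (Continuous.intervalIntegrable (by fun_prop) _ _),
      intervalIntegral.integral_const_mul, intervalIntegral.integral_const_mul, hmean,
      intervalIntegral.integral_const]
    simp only [smul_eq_mul]
    ring
  exact heq ▸ hle

/-- A differential form of Grönwall's inequality on `[0, ∞)`. -/
theorem le_mul_exp_of_hasDerivAt_le {f f' : ℝ → ℝ} {k : ℝ} (hf : ∀ t, HasDerivAt f (f' t) t)
    (hle : ∀ t, 0 ≤ t → f' t ≤ -k * f t) {t : ℝ} (ht : 0 ≤ t) :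
    f t ≤ f 0 * Real.exp (-k * t) := by
  have hd (s : ℝ) : HasDerivAt (fun s => f s * Real.exp (k * s))
      (f' s * Real.exp (k * s) + f s * (Real.exp (k * s) * k)) s := by
    have hexp : HasDerivAt (fun s => k * s) k s := by
      simpa using (hasDerivAt_id s).const_mul k
    exact (hf s).mul hexp.exp
  have hanti : AntitoneOn (fun s => f s * Real.exp (k * s)) (Ici 0) := by
    refine antitoneOn_of_deriv_nonpos (convex_Ici 0)
      (fun s _ => (hd s).continuousAt.continuousWithinAt)
      (fun s _ => (hd s).differentiableAt.differentiableWithinAt) fun s hs => ?_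
    rw [(hd s).deriv]
    rw [interior_Ici] at hs
    nlinarith [hle s hs.le, Real.exp_pos (k * s)]
  have h0 := hanti self_mem_Ici ht ht
  simp only [mul_zero, Real.exp_zero, mul_one] at h0
  rw [neg_mul, Real.exp_neg, ← div_eq_mul_inv, le_div_iff₀ (Real.exp_pos _)]
  exact h0

/-- exponential decay of the energy and exponential L²
convergence to equilibrium for smooth mean-zero solutions of the Metropolis
crystal-surface PDE, with λ = (2π/L)⁴ and minimum energy L = φ(0). -/
theorem exponential_convergence_to_equilibrium
    (L : ℝ) (hL : 0 < L)
    (h : ℝ → ℝ → ℝ)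
    (hsmooth : ContDiff ℝ (⊤ : ℕ∞) (fun p : ℝ × ℝ => h p.1 p.2))
    (hper : ∀ t x, h t (x + L) = h t x)
    (hpde : ∀ t x, 0 ≤ t →
      deriv (fun s => h s x) t
        = - deriv (deriv (fun y => Real.sinh (deriv (deriv (h t)) y))) x)
    (hmean0 : ∫ x in (0:ℝ)..L, h 0 x = 0) :
    ∀ t, 0 ≤ t →
      ((∫ x in (0:ℝ)..L, Real.cosh (deriv (deriv (h t)) x)) - L
          ≤ ((∫ x in (0:ℝ)..L, Real.cosh (deriv (deriv (h 0)) x)) - L)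
              * Real.exp (-2 * (2 * Real.pi / L) ^ 4 * t))
      ∧ (((2 * Real.pi / L) ^ 4 / 2) * (∫ x in (0:ℝ)..L, (h t x) ^ 2)
          ≤ (∫ x in (0:ℝ)..L, Real.cosh (deriv (deriv (h t)) x)) - L)
      ∧ ((∫ x in (0:ℝ)..L, (h t x) ^ 2)
          ≤ (2 / (2 * Real.pi / L) ^ 4)
              * ((∫ x in (0:ℝ)..L, Real.cosh (deriv (deriv (h 0)) x)) - L)
              * Real.exp (-2 * (2 * Real.pi / L) ^ 4 * t)) := by
  set H : ℝ × ℝ → ℝ := fun p => h p.1 p.2 with hH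
  set U := directionalDeriv (0, 1) (directionalDeriv (0, 1) H) with hU
  set W : ℝ × ℝ → ℝ := fun p => Real.sinh (U p)
  set V := directionalDeriv (1, 0) H
  set W' := directionalDeriv (0, 1) W
  set W'' := directionalDeriv (0, 1) W'
  have H_smooth : ContDiff ℝ ∞ H := hsmooth
  have Hx_smooth := contDiff_directionalDeriv H_smooth (0, 1)
  have U_smooth : ContDiff ℝ ∞ U := contDiff_directionalDeriv Hx_smooth (0, 1)
  have V_smooth : ContDiff ℝ ∞ V := contDiff_directionalDeriv H_smooth (1, 0)
  have Vx_smooth := contDiff_directionalDeriv V_smooth (0, 1)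
  have W_smooth : ContDiff ℝ ∞ W := Real.contDiff_sinh.comp U_smooth
  have W'_smooth : ContDiff ℝ ∞ W' := contDiff_directionalDeriv W_smooth (0, 1)
  have W''_smooth : ContDiff ℝ ∞ W'' := contDiff_directionalDeriv W'_smooth (0, 1)
  have slice {G : ℝ × ℝ → ℝ} (hG : ContDiff ℝ ∞ G) (t : ℝ) : Continuous fun x => G (t, x) :=
    hG.continuous.comp (Continuous.prodMk_right t)
  have H_per : Function.Periodic H (0, L) := fun p => by simp [hH, hper]
  have Hx_per := directionalDeriv_periodic H_per (0, 1)
  have U_per : Function.Periodic U (0, L) := directionalDeriv_periodic Hx_per (0, 1)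
  have V_per : Function.Periodic V (0, L) := directionalDeriv_periodic H_per (1, 0)
  have Vx_per := directionalDeriv_periodic V_per (0, 1)
  have W_per : Function.Periodic W (0, L) := fun p => congrArg Real.sinh (U_per p)
  have W'_per : Function.Periodic W' (0, L) := directionalDeriv_periodic W_per (0, 1)
  have boundary {G : ℝ × ℝ → ℝ} (hG : Function.Periodic G (0, L)) (t : ℝ) :
      G (t, L) = G (t, 0) := by simpa using hG (t, 0)
  have hxx (t : ℝ) : deriv (deriv (h t)) = fun x => U (t, x) :=
    (congrArg deriv (deriv_snd_eq_directionalDeriv H_smooth t)).trans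
      (deriv_snd_eq_directionalDeriv Hx_smooth t)
  have pde (t x : ℝ) (ht : 0 ≤ t) : V (t, x) = -W'' (t, x) := by
    have := hpde t x ht
    rw [hxx] at this
    have h2 : deriv (deriv fun y => Real.sinh (U (t, y))) = fun x => W'' (t, x) :=
      (congrArg deriv (deriv_snd_eq_directionalDeriv W_smooth t)).trans
        (deriv_snd_eq_directionalDeriv W'_smooth t)
    rw [h2] at this
    exact (deriv_fst_eq_directionalDeriv H_smooth t x).symm.trans this
  have mean_zero (t : ℝ) (ht : 0 ≤ t) : ∫ x in (0 : ℝ)..L, H (t, x) = 0 := by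
    have hd := hasDerivAt_integral_directionalDeriv H_smooth 0 L
    have hzero (s : ℝ) (hs : 0 ≤ s) : ∫ x in (0 : ℝ)..L, V (s, x) = 0 := by
      simp only [pde s _ hs, intervalIntegral.integral_neg]
      rw [intervalIntegral.integral_eq_sub_of_hasDerivAt
        (fun x _ => hasDerivAt_snd_directionalDeriv W'_smooth s x)
        ((slice W''_smooth s).intervalIntegrable _ _), boundary W'_per, sub_self, neg_zero]
    have hconst := constant_of_has_deriv_right_zero (a := 0) (b := t)
      (fun s _ => (hd s).continuousAt.continuousWithinAt)
      (fun s hs => ((hd s).congr_deriv (hzero s hs.1)).hasDerivWithinAt)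
    exact (hconst t (right_mem_Icc.2 ht)).trans hmean0
  have U_mean (t : ℝ) : ∫ x in (0 : ℝ)..L, U (t, x) = 0 := by
    rw [intervalIntegral.integral_eq_sub_of_hasDerivAt
      (fun x _ => hasDerivAt_snd_directionalDeriv Hx_smooth t x)
      ((slice U_smooth t).intervalIntegrable _ _), boundary Hx_per, sub_self]
  have U_t : directionalDeriv (1, 0) U =
      directionalDeriv (0, 1) (directionalDeriv (0, 1) V) := by
    rw [hU, directionalDeriv_comm Hx_smooth, directionalDeriv_comm H_smooth]
  have energy_deriv (t : ℝ) : HasDerivAt (fun s => (∫ x in (0 : ℝ)..L, Real.cosh (U (s, x))) - L)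
      (∫ x in (0 : ℝ)..L, W'' (t, x) * V (t, x)) t := by
    have hd := (hasDerivAt_integral_directionalDeriv
      (Real.contDiff_cosh.comp U_smooth) 0 L t).sub_const L
    refine hd.congr_deriv (Eq.symm ?_)
    rw [← integral_mul_second_deriv_eq (hasDerivAt_snd_directionalDeriv W_smooth t)
      (hasDerivAt_snd_directionalDeriv W'_smooth t) (slice W''_smooth t)
      (hasDerivAt_snd_directionalDeriv V_smooth t) (hasDerivAt_snd_directionalDeriv Vx_smooth t)
      (slice (contDiff_directionalDeriv Vx_smooth (0, 1)) t)
      (boundary W_per t) (boundary W'_per t) (boundary V_per t) (boundary Vx_per t)]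
    refine intervalIntegral.integral_congr fun x _ => ?_
    rw [← U_t, ← deriv_fst_eq_directionalDeriv (Real.contDiff_cosh.comp U_smooth)]
    exact (hasDerivAt_fst_directionalDeriv U_smooth t x).cosh.deriv.symm
  have dissipation (t : ℝ) (ht : 0 ≤ t) : ∫ x in (0 : ℝ)..L, W'' (t, x) * V (t, x) ≤
      -(2 * (2 * Real.pi / L) ^ 4) * ((∫ x in (0 : ℝ)..L, Real.cosh (U (t, x))) - L) := by
    set c := L⁻¹ * ∫ x in (0 : ℝ)..L, W (t, x) with hc
    have hmean : ∫ x in (0 : ℝ)..L, (W (t, x) - c) = 0 := by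
      rw [intervalIntegral.integral_sub ((slice W_smooth t).intervalIntegrable _ _)
        (continuous_const.intervalIntegrable _ _), intervalIntegral.integral_const, hc]
      simp only [sub_zero, smul_eq_mul]
      field_simp
      ring
    have hwirt := wirtinger_inequality_second_order hL
      (fun x => (hasDerivAt_snd_directionalDeriv W_smooth t x).sub_const c)
      (hasDerivAt_snd_directionalDeriv W'_smooth t) (slice W''_smooth t)
      (by rw [boundary W_per]) (boundary W'_per t) hmean
    have hvar := two_mul_integral_cosh_sub_le hL (slice U_smooth t) (U_mean t) c
    have hsq : ∫ x in (0 : ℝ)..L, W'' (t, x) * V (t, x) =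
        -∫ x in (0 : ℝ)..L, W'' (t, x) ^ 2 := by
      rw [← intervalIntegral.integral_neg]
      refine intervalIntegral.integral_congr fun x _ => ?_
      simp only [pde t x ht]
      ring
    rw [hsq]
    have := mul_le_mul_of_nonneg_left hvar (show 0 ≤ (2 * Real.pi / L) ^ 4 by positivity)
    linarith
  have decay (t : ℝ) (ht : 0 ≤ t) := le_mul_exp_of_hasDerivAt_le energy_deriv dissipation ht
  have coercive (t : ℝ) (ht : 0 ≤ t) : (2 * Real.pi / L) ^ 4 / 2 *
      (∫ x in (0 : ℝ)..L, H (t, x) ^ 2) ≤ (∫ x in (0 : ℝ)..L, Real.cosh (U (t, x))) - L := by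
    have hwirt := wirtinger_inequality_second_order hL
      (hasDerivAt_snd_directionalDeriv H_smooth t) (hasDerivAt_snd_directionalDeriv Hx_smooth t)
      (slice U_smooth t) (boundary H_per t) (boundary Hx_per t) (mean_zero t ht)
    have hU2 : Continuous fun x => U (t, x) ^ 2 / 2 := ((slice U_smooth t).pow 2).div_const 2
    have hle : ∫ x in (0 : ℝ)..L, (1 + U (t, x) ^ 2 / 2) ≤
        ∫ x in (0 : ℝ)..L, Real.cosh (U (t, x)) :=
      intervalIntegral.integral_mono_on hL.le
        ((continuous_const.add hU2).intervalIntegrable _ _)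
        ((Real.continuous_cosh.comp (slice U_smooth t)).intervalIntegrable _ _)
        fun x _ => one_add_sq_div_two_le_cosh _
    rw [intervalIntegral.integral_add (continuous_const.intervalIntegrable _ _)
      (hU2.intervalIntegrable _ _), intervalIntegral.integral_div,
      intervalIntegral.integral_const] at hle
    simp only [sub_zero, smul_eq_mul, mul_one] at hle
    change _ * _ ≤ ∫ x in (0 : ℝ)..L, U (t, x) ^ 2 at hwirt
    linarith
  intro t ht
  simp only [hxx]
  have hdecay := decay t ht
  rw [show -(2 * (2 * Real.pi / L) ^ 4) * t = -2 * (2 * Real.pi / L) ^ 4 * t by ring] at hdecay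
  refine ⟨hdecay, coercive t ht, ?_⟩
  have hlam : 0 < (2 * Real.pi / L) ^ 4 := by have := Real.pi_pos; positivity
  have hfinal := (coercive t ht).trans hdecay
  rw [mul_assoc, div_mul_eq_mul_div, le_div_iff₀ hlam]
  change (∫ x in (0 : ℝ)..L, h t x ^ 2) * _ ≤ _
  change _ * (∫ x in (0 : ℝ)..L, h t x ^ 2) ≤ _ at hfinal
  linarith
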